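/- (Fano's inequality, binary case.) Let Ω be a finite probability space, let X : Ω → {0,1} and Y : Ω → S be random variables with S a finite set, and let f : S → {0,1} be any prediction function. If ε = Pr[f(Y) ≠ X] is the probability of error made by the prediction function, then H(X | Y) ≤ H_b(ε). -/

import Mathlib

open Finset

open scoped Classical

/-- Probability of an event `E` under the weight function `μ` on a finite sample space. -/
noncomputable def prob {Ω : Type*} [Fintype Ω] (μ : Ω → ℝ) (E : Ω → Prop) : ℝ :=
  ∑ ω, if E ω then μ ω else 0

/-- Shannon entropy (in nats) of a finitely-valued random variable `V`. -/
noncomputable def entropy {Ω α : Type*} [Fintype Ω] [Fintype α]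
    (μ : Ω → ℝ) (V : Ω → α) : ℝ :=
  -∑ a, prob μ (fun ω => V ω = a) * Real.log (prob μ (fun ω => V ω = a))

/-- Conditional Shannon entropy (in nats) `H(V | W) = ∑_b P[W = b] · H(V | W = b)`. -/
noncomputable def condEntropy {Ω α β : Type*} [Fintype Ω] [Fintype α] [Fintype β]
    (μ : Ω → ℝ) (V : Ω → α) (W : Ω → β) : ℝ :=
  ∑ b, prob μ (fun ω => W ω = b) *
    (-∑ a, (prob μ (fun ω => V ω = a ∧ W ω = b) / prob μ (fun ω => W ω = b)) *
        Real.log (prob μ (fun ω => V ω = a ∧ W ω = b) / prob μ (fun ω => W ω = b)))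

/-- Mutual information (in nats) `I(V : W) = H(V) − H(V | W)`. -/
noncomputable def mutualInfo {Ω α β : Type*} [Fintype Ω] [Fintype α] [Fintype β]
    (μ : Ω → ℝ) (V : Ω → α) (W : Ω → β) : ℝ :=
  entropy μ V - condEntropy μ V W


/-- The binary entropy function (in nats), with the convention `H_b 0 = H_b 1 = 0`. -/
noncomputable def binEntropy (p : ℝ) : ℝ :=
  -(p * Real.log p) - (1 - p) * Real.log (1 - p)

theorem prob_nonneg {Ω : Type*} [Fintype Ω] {μ : Ω → ℝ} (hμ : ∀ ω, 0 ≤ μ ω) (E : Ω → Prop) :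
    0 ≤ prob μ E :=
  Finset.sum_nonneg fun ω _ => by split_ifs <;> simp [hμ ω]

/-- Law of total probability over the values of a finitely-valued random variable. -/
theorem sum_prob_and_eq {Ω S : Type*} [Fintype Ω] [Fintype S] (μ : Ω → ℝ) (E : Ω → Prop)
    (Y : Ω → S) : ∑ b, prob μ (fun ω => E ω ∧ Y ω = b) = prob μ E := by
  unfold prob
  rw [Finset.sum_comm]
  refine Finset.sum_congr rfl fun ω _ => ?_
  by_cases h : E ω <;> simp [h]

theorem prob_and_add_prob_not_and {Ω : Type*} [Fintype Ω] (μ : Ω → ℝ) (E F : Ω → Prop) :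
    prob μ (fun ω => E ω ∧ F ω) + prob μ (fun ω => ¬ E ω ∧ F ω) = prob μ F := by
  unfold prob
  rw [← Finset.sum_add_distrib]
  refine Finset.sum_congr rfl fun ω _ => ?_
  by_cases h : E ω <;> simp [h]

theorem binEntropy_eq_real_binEntropy (p : ℝ) : binEntropy p = Real.binEntropy p := by
  simp only [binEntropy, Real.binEntropy, Real.log_inv]
  ring

/-- The conditional entropy of a binary variable, in terms of the error probabilities of an
arbitrary predictor on each fibre of the conditioning variable. -/
theorem condEntropy_bool_eq {Ω S : Type*} [Fintype Ω] [Fintype S] (μ : Ω → ℝ)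
    (X : Ω → Bool) (Y : Ω → S) (f : S → Bool) :
    condEntropy μ X Y = ∑ b, prob μ (fun ω => Y ω = b) *
      Real.binEntropy (prob μ (fun ω => f (Y ω) ≠ X ω ∧ Y ω = b) /
        prob μ (fun ω => Y ω = b)) := by
  refine Finset.sum_congr rfl fun b _ => ?_
  by_cases hw : prob μ (fun ω => Y ω = b) = 0
  · simp [hw]
  have herr : (fun ω => f (Y ω) ≠ X ω ∧ Y ω = b) = fun ω => X ω = !f b ∧ Y ω = b := by
    funext ω
    refine propext (and_congr_left fun h => ?_)
    subst h
    cases f (Y ω) <;> cases X ω <;> simp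
  have hsplit : prob μ (fun ω => X ω = !f b ∧ Y ω = b) +
      prob μ (fun ω => X ω = f b ∧ Y ω = b) = prob μ (fun ω => Y ω = b) := by
    simpa using prob_and_add_prob_not_and μ (fun ω => X ω = !f b) (fun ω => Y ω = b)
  have hcompl : prob μ (fun ω => X ω = f b ∧ Y ω = b) / prob μ (fun ω => Y ω = b) =
      1 - prob μ (fun ω => X ω = !f b ∧ Y ω = b) / prob μ (fun ω => Y ω = b) := by
    field_simp
    linarith
  congr 1
  rw [herr, ← binEntropy_eq_real_binEntropy, binEntropy, ← hcompl, Fintype.sum_bool]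
  cases f b <;> simp only [Bool.not_true, Bool.not_false] <;> ring

theorem stmt_2 {Ω S : Type*} [Fintype Ω] [Fintype S]
    (μ : Ω → ℝ) (hμ0 : ∀ ω, 0 ≤ μ ω) (hμ1 : ∑ ω, μ ω = 1)
    (X : Ω → Bool) (Y : Ω → S) (f : S → Bool) (ε : ℝ)
    (hε : ε = prob μ (fun ω => f (Y ω) ≠ X ω)) :
    condEntropy μ X Y ≤ binEntropy ε := by
  rw [binEntropy_eq_real_binEntropy, condEntropy_bool_eq μ X Y f, hε]
  have hsum : ∑ b, prob μ (fun ω => Y ω = b) = 1 := by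
    have h := sum_prob_and_eq μ (fun _ => True) Y
    simpa [prob, hμ1] using h
  have hsplit := fun b => prob_and_add_prob_not_and μ (fun ω => f (Y ω) ≠ X ω) (fun ω => Y ω = b)
  have hw := fun b => prob_nonneg hμ0 (fun ω => Y ω = b)
  have he := fun b => prob_nonneg hμ0 (fun ω => f (Y ω) ≠ X ω ∧ Y ω = b)
  have hc := fun b => prob_nonneg hμ0 (fun ω => ¬ f (Y ω) ≠ X ω ∧ Y ω = b)
  have hJensen := Real.strictConcave_binEntropy.concaveOn.le_map_sum
    (t := Finset.univ) (w := fun b => prob μ (fun ω => Y ω = b))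
    (p := fun b => prob μ (fun ω => f (Y ω) ≠ X ω ∧ Y ω = b) / prob μ (fun ω => Y ω = b))
    (fun b _ => hw b) hsum
    (fun b _ => ⟨div_nonneg (he b) (hw b),
      div_le_one_of_le₀ (by linarith [hsplit b, hc b]) (hw b)⟩)
  simp only [smul_eq_mul] at hJensen
  refine hJensen.trans_eq (congrArg Real.binEntropy ?_)
  rw [← sum_prob_and_eq μ _ Y]
  refine Finset.sum_congr rfl fun b _ => ?_
  exact mul_div_cancel_of_imp' fun h => by linarith [hsplit b, he b, hc b]
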